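/- Let N be a positive integer, Λ ∈ GL(N,ℝ), and let G be a smooth harmonic-Einstein map from ℝ to the symmetric positive-definite real N×N matrices such that G and G' both satisfy the Λ-holonomy boundary condition. Let h be a smooth map from ℝ to the symmetric real N×N matrices such that h and h' both satisfy the Λ-holonomy boundary condition. Then ∫₀¹ ⟨(L₂h)(ξ), h(ξ)⟩_{G(ξ)} dξ = −∫₀¹ ‖h'(ξ)‖²_{G(ξ)} dξ − ∫₀¹ ‖G'(ξ) G(ξ)⁻¹ h(ξ)‖²_{G(ξ)} dξ + 2 ∫₀¹ ⟨G'(ξ) G(ξ)⁻¹ h(ξ), h'(ξ)⟩_{G(ξ)} dξ. -/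

import Mathlib

open Matrix

/-- The fiberwise inner product `⟨φ,ψ⟩_G = tr(G⁻¹ φ G⁻¹ ψᵀ)`. -/
noncomputable def innerG {N : ℕ} (G φ ψ : Matrix (Fin N) (Fin N) ℝ) : ℝ :=
  (G⁻¹ * φ * G⁻¹ * ψᵀ).trace

/-- The Λ-holonomy boundary condition `φ(1) = Λᵀ φ(0) Λ`. -/
def holBC {N : ℕ} (Λ : Matrix (Fin N) (Fin N) ℝ)
    (φ : ℝ → Matrix (Fin N) (Fin N) ℝ) : Prop :=
  φ 1 = Λᵀ * φ 0 * Λ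

/-- The operator `L₂` associated to a fiber metric `G` (with derivative `G'`),
acting on `h` with derivatives `h'`, `h''`. -/
noncomputable def L2 {N : ℕ} (G G' h h' h'' : ℝ → Matrix (Fin N) (Fin N) ℝ)
    (ξ : ℝ) : Matrix (Fin N) (Fin N) ℝ :=
  h'' ξ - h' ξ * (G ξ)⁻¹ * G' ξ - G' ξ * (G ξ)⁻¹ * h' ξ
    + G' ξ * (G ξ)⁻¹ * h ξ * (G ξ)⁻¹ * G' ξ

section MatrixCalculus

attribute [local instance] Matrix.linftyOpNormedRing Matrix.linftyOpNormedAlgebra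

variable {N : ℕ}

theorem hasDerivAt_matrix_of_entries {A : ℝ → Matrix (Fin N) (Fin N) ℝ}
    {A' : Matrix (Fin N) (Fin N) ℝ} {x : ℝ}
    (hA : ∀ i j, HasDerivAt (fun t => A t i j) (A' i j) x) : HasDerivAt A A' x :=
  hasDerivAt_pi.2 fun i => hasDerivAt_pi.2 fun j => hA i j

theorem hasDerivAt_matrix_inv {A : ℝ → Matrix (Fin N) (Fin N) ℝ}
    {A' : Matrix (Fin N) (Fin N) ℝ} {x : ℝ} (hA : HasDerivAt A A' x) (hu : IsUnit (A x)) :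
    HasDerivAt (fun t => (A t)⁻¹) (-((A x)⁻¹ * A' * (A x)⁻¹)) x := by
  obtain ⟨u, hu⟩ := hu
  have hinv := hasFDerivAt_ringInverse (𝕜 := ℝ) u
  rw [hu] at hinv
  have h := hinv.comp_hasDerivAt x hA
  have hfun : (fun t => (A t)⁻¹) = Ring.inverse ∘ A :=
    funext fun t => Matrix.nonsing_inv_eq_ringInverse (A t)
  rw [hfun]
  refine h.congr_deriv ?_
  simp [← hu]

theorem continuous_matrix_inv {A A' : ℝ → Matrix (Fin N) (Fin N) ℝ}
    (hA : ∀ x, HasDerivAt A (A' x) x) (hu : ∀ x, IsUnit (A x)) :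
    Continuous fun t => (A t)⁻¹ :=
  continuous_iff_continuousAt.2 fun x => (hasDerivAt_matrix_inv (hA x) (hu x)).continuousAt

theorem HasDerivAt.matrix_trace {A : ℝ → Matrix (Fin N) (Fin N) ℝ}
    {A' : Matrix (Fin N) (Fin N) ℝ} {x : ℝ} (hA : HasDerivAt A A' x) :
    HasDerivAt (fun t => (A t).trace) A'.trace x :=
  (LinearMap.toContinuousLinearMap
    (Matrix.traceLinearMap (Fin N) ℝ ℝ)).hasFDerivAt.comp_hasDerivAt x hA

/-- The derivative of `tr(G⁻¹ h' G⁻¹ h) - tr(G⁻¹ G' (G⁻¹ h)²)` along a solution of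
`G'' = G' G⁻¹ G'`. -/
theorem hasDerivAt_energy_primitive {G G' G'' h h' h'' : ℝ → Matrix (Fin N) (Fin N) ℝ} {x : ℝ}
    (hG : HasDerivAt G (G' x) x) (hG' : HasDerivAt G' (G'' x) x) (hu : IsUnit (G x))
    (hHE : G'' x = G' x * (G x)⁻¹ * G' x)
    (hh : HasDerivAt h (h' x) x) (hh' : HasDerivAt h' (h'' x) x)
    (hGs : (G x).IsSymm) (hGs' : (G' x).IsSymm) (hs : (h x).IsSymm) (hs' : (h' x).IsSymm) :
    HasDerivAt (fun t => ((G t)⁻¹ * h' t * ((G t)⁻¹ * h t)).trace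
        - ((G t)⁻¹ * G' t * ((G t)⁻¹ * h t * ((G t)⁻¹ * h t))).trace)
      (innerG (G x) (L2 G G' h h' h'' x) (h x) + innerG (G x) (h' x) (h' x)
        + innerG (G x) (G' x * (G x)⁻¹ * h x) (G' x * (G x)⁻¹ * h x)
        - 2 * innerG (G x) (G' x * (G x)⁻¹ * h x) (h' x)) x := by
  have hP := hasDerivAt_matrix_inv hG hu
  have hPs : ((G x)⁻¹)ᵀ = (G x)⁻¹ := by rw [Matrix.transpose_nonsing_inv, hGs.eq]
  have hH := hP.mul hh
  have key := ((hP.mul hh').mul hH).matrix_trace.sub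
    ((hP.mul hG').mul (hH.mul hH)).matrix_trace
  refine key.congr_deriv ?_
  simp only [innerG, L2, Matrix.transpose_mul, hPs, hGs'.eq, hs.eq, hs'.eq, hHE, Pi.mul_apply]
  generalize (G x)⁻¹ = P at hPs ⊢
  generalize G' x = B at hGs' ⊢
  generalize h x = k at hs ⊢
  generalize h' x = l at hs' ⊢
  generalize h'' x = m
  have reflect : (P * (B * (P * (l * (P * k))))).trace
      = (P * (B * (P * (k * (P * l))))).trace := by
    rw [← Matrix.trace_transpose]
    simp only [Matrix.transpose_mul, hPs, hGs'.eq, hs.eq, hs'.eq]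
    rw [Matrix.trace_mul_comm, ← Matrix.mul_assoc P B, Matrix.trace_mul_comm (P * B)]
    simp only [Matrix.mul_assoc]
  have rotate : (P * (B * (P * (k * (P * (k * (P * B))))))).trace
      = (P * (B * (P * (B * (P * (k * (P * k))))))).trace := by
    rw [← Matrix.mul_assoc P B (P * (B * (P * (k * (P * k))))), Matrix.trace_mul_comm (P * B)]
    simp only [Matrix.mul_assoc]
  simp only [Matrix.mul_add, Matrix.add_mul, Matrix.mul_sub, Matrix.sub_mul, Matrix.mul_neg,
    Matrix.neg_mul, Matrix.mul_assoc, Matrix.trace_add, Matrix.trace_sub, Matrix.trace_neg,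
    reflect, rotate]
  ring

end MatrixCalculus

theorem isSymm_of_hasDerivAt {N : ℕ} {A : ℝ → Matrix (Fin N) (Fin N) ℝ}
    {A' : Matrix (Fin N) (Fin N) ℝ} {x : ℝ}
    (hA : ∀ i j, HasDerivAt (fun t => A t i j) (A' i j) x) (hs : ∀ t, (A t).IsSymm) :
    A'.IsSymm := by
  ext i j
  refine (hA j i).unique ?_
  simpa only [fun t => (hs t).apply i j] using hA i j

theorem continuous_innerG {N : ℕ} {G φ ψ : ℝ → Matrix (Fin N) (Fin N) ℝ}
    (hG : Continuous fun ξ => (G ξ)⁻¹) (hφ : Continuous φ) (hψ : Continuous ψ) :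
    Continuous fun ξ => innerG (G ξ) (φ ξ) (ψ ξ) :=
  (((hG.matrix_mul hφ).matrix_mul hG).matrix_mul hψ.matrix_transpose).matrix_trace

/-- Under the holonomy boundary condition the endomorphism `G⁻¹ φ` is conjugated by `Λ`. -/
theorem holBC.inv_mul {N : ℕ} {Λ : Matrix (Fin N) (Fin N) ℝ} (hΛ : IsUnit Λ)
    {G φ : ℝ → Matrix (Fin N) (Fin N) ℝ} (hG : holBC Λ G) (hφ : holBC Λ φ) :
    (G 1)⁻¹ * φ 1 = Λ⁻¹ * ((G 0)⁻¹ * φ 0) * Λ := by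
  have hdet : IsUnit Λᵀ.det := by
    rw [Matrix.det_transpose]
    exact (Matrix.isUnit_iff_isUnit_det Λ).1 hΛ
  rw [hG, hφ, Matrix.mul_inv_rev, Matrix.mul_inv_rev]
  simp only [Matrix.mul_assoc]
  rw [Matrix.nonsing_inv_mul_cancel_left _ _ hdet]

theorem conj_mul_conj {N : ℕ} {Λ : Matrix (Fin N) (Fin N) ℝ} (hΛ : IsUnit Λ)
    (A B : Matrix (Fin N) (Fin N) ℝ) :
    Λ⁻¹ * A * Λ * (Λ⁻¹ * B * Λ) = Λ⁻¹ * (A * B) * Λ := by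
  have hdet := (Matrix.isUnit_iff_isUnit_det Λ).1 hΛ
  simp only [Matrix.mul_assoc]
  rw [Matrix.mul_nonsing_inv_cancel_left _ _ hdet]

theorem trace_inv_mul_mul {N : ℕ} {Λ : Matrix (Fin N) (Fin N) ℝ} (hΛ : IsUnit Λ)
    (A : Matrix (Fin N) (Fin N) ℝ) : (Λ⁻¹ * A * Λ).trace = A.trace := by
  have hdet := (Matrix.isUnit_iff_isUnit_det Λ).1 hΛ
  rw [Matrix.trace_mul_comm, ← Matrix.mul_assoc, Matrix.mul_nonsing_inv _ hdet, Matrix.one_mul]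

theorem continuous_of_contDiff_hasDerivAt_hasDerivAt {f f' f'' : ℝ → ℝ} (hf : ContDiff ℝ 2 f)
    (hf' : ∀ x, HasDerivAt f (f' x) x) (hf'' : ∀ x, HasDerivAt f' (f'' x) x) :
    Continuous f'' := by
  have h1 : deriv f = f' := funext fun x => (hf' x).deriv
  have h2 : deriv f' = f'' := funext fun x => (hf'' x).deriv
  have h := hf.continuous_iteratedDeriv 2 le_rfl
  rwa [iteratedDeriv_succ, iteratedDeriv_one, h1, h2] at h

theorem L2_energy_identity {N : ℕ} (hN : 0 < N)
    (Λ : Matrix (Fin N) (Fin N) ℝ) (hΛ : IsUnit Λ)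
    (G G' G'' h h' h'' : ℝ → Matrix (Fin N) (Fin N) ℝ)
    (hGsmooth : ∀ i j, ContDiff ℝ (⊤ : ℕ∞) fun ξ => G ξ i j)
    (hGderiv : ∀ ξ i j, HasDerivAt (fun t => G t i j) (G' ξ i j) ξ)
    (hGderiv2 : ∀ ξ i j, HasDerivAt (fun t => G' t i j) (G'' ξ i j) ξ)
    (hGpos : ∀ ξ, (G ξ).PosDef)
    (hHE : ∀ ξ, G'' ξ = G' ξ * (G ξ)⁻¹ * G' ξ)
    (hGbc : holBC Λ G) (hG'bc : holBC Λ G')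
    (hhsmooth : ∀ i j, ContDiff ℝ (⊤ : ℕ∞) fun ξ => h ξ i j)
    (hhderiv : ∀ ξ i j, HasDerivAt (fun t => h t i j) (h' ξ i j) ξ)
    (hhderiv2 : ∀ ξ i j, HasDerivAt (fun t => h' t i j) (h'' ξ i j) ξ)
    (hhsymm : ∀ ξ, (h ξ).IsSymm)
    (hhbc : holBC Λ h) (hh'bc : holBC Λ h') :
    (∫ ξ in (0:ℝ)..1, innerG (G ξ) (L2 G G' h h' h'' ξ) (h ξ)) =
      -(∫ ξ in (0:ℝ)..1, innerG (G ξ) (h' ξ) (h' ξ))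
        - (∫ ξ in (0:ℝ)..1,
            innerG (G ξ) (G' ξ * (G ξ)⁻¹ * h ξ) (G' ξ * (G ξ)⁻¹ * h ξ))
        + 2 * ∫ ξ in (0:ℝ)..1,
            innerG (G ξ) (G' ξ * (G ξ)⁻¹ * h ξ) (h' ξ) := by
  have hu : ∀ ξ, IsUnit (G ξ) := fun ξ => (hGpos ξ).isUnit
  have hGs : ∀ ξ, (G ξ).IsSymm := fun ξ =>
    (Matrix.conjTranspose_eq_transpose_of_trivial (G ξ)).symm.trans (hGpos ξ).isHermitian.eq
  have hderiv : ∀ ξ, _ := fun ξ => hasDerivAt_energy_primitive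
    (hasDerivAt_matrix_of_entries (hGderiv ξ)) (hasDerivAt_matrix_of_entries (hGderiv2 ξ))
    (hu ξ) (hHE ξ) (hasDerivAt_matrix_of_entries (hhderiv ξ))
    (hasDerivAt_matrix_of_entries (hhderiv2 ξ)) (hGs ξ)
    (isSymm_of_hasDerivAt (hGderiv ξ) hGs) (hhsymm ξ) (isSymm_of_hasDerivAt (hhderiv ξ) hhsymm)
  have cP : Continuous fun ξ => (G ξ)⁻¹ :=
    continuous_matrix_inv (fun ξ => hasDerivAt_matrix_of_entries (hGderiv ξ)) hu
  have cG' : Continuous G' := continuous_matrix fun i j =>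
    continuous_iff_continuousAt.2 fun ξ => (hGderiv2 ξ i j).continuousAt
  have ch : Continuous h := continuous_matrix fun i j =>
    continuous_iff_continuousAt.2 fun ξ => (hhderiv ξ i j).continuousAt
  have ch' : Continuous h' := continuous_matrix fun i j =>
    continuous_iff_continuousAt.2 fun ξ => (hhderiv2 ξ i j).continuousAt
  have ch'' : Continuous h'' := continuous_matrix fun i j =>
    continuous_of_contDiff_hasDerivAt_hasDerivAt
      (contDiff_infty.1 (hhsmooth i j) 2)
      (fun ξ => hhderiv ξ i j) (fun ξ => hhderiv2 ξ i j)
  have cM := (cG'.matrix_mul cP).matrix_mul ch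
  have cL : Continuous (L2 G G' h h' h'') :=
    ((ch''.sub ((ch'.matrix_mul cP).matrix_mul cG')).sub
      ((cG'.matrix_mul cP).matrix_mul ch')).add ((cM.matrix_mul cP).matrix_mul cG')
  have iL := (continuous_innerG cP cL ch).intervalIntegrable (μ := MeasureTheory.volume) 0 1
  have iK := (continuous_innerG cP ch' ch').intervalIntegrable (μ := MeasureTheory.volume) 0 1
  have iM := (continuous_innerG cP cM cM).intervalIntegrable (μ := MeasureTheory.volume) 0 1
  have iX := ((continuous_innerG cP cM ch').intervalIntegrable
    (μ := MeasureTheory.volume) 0 1).const_mul 2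
  have hFTC := intervalIntegral.integral_eq_sub_of_hasDerivAt (fun ξ _ => hderiv ξ)
    (((iL.add iK).add iM).sub iX)
  rw [intervalIntegral.integral_sub ((iL.add iK).add iM) iX,
    intervalIntegral.integral_add (iL.add iK) iM, intervalIntegral.integral_add iL iK,
    intervalIntegral.integral_const_mul, hGbc.inv_mul hΛ hhbc, hGbc.inv_mul hΛ hh'bc,
    hGbc.inv_mul hΛ hG'bc] at hFTC
  simp only [conj_mul_conj hΛ, trace_inv_mul_mul hΛ] at hFTC
  linarith
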